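/- Fix α ∈ ℝ. Let V(ν₁,ν₂,r) be the 4×4 squeezed-thermal covariance matrix in standard form with symplectic eigenvalues ν₁, ν₂ ≥ 1/2 and squeezing strength r > 0, and let D(V) = JBV + VBJ − JAJ be the linear dissipator engineered to preserve two-mode squeezed states with squeezing strength α, where B = J/2 and A = ½[[cosh(2α)·I₂, −sinh(2α)·η₂],[−sinh(2α)·η₂, cosh(2α)·I₂]] with η₂ = diag(1,−1). Then there exists a real symmetric 4×4 matrix G with JGV − VGJ + D(V) = 0 if and only if ν₁ = ν₂ = cosh(2(r−α))/2. -/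

import Mathlib

open Matrix

noncomputable def J4 : Matrix (Fin 4) (Fin 4) ℝ :=
  !![0, 1, 0, 0; -1, 0, 0, 0; 0, 0, 0, 1; 0, 0, -1, 0]

noncomputable def Vsf (ν₁ ν₂ r : ℝ) : Matrix (Fin 4) (Fin 4) ℝ :=
  !![ν₁ * Real.cosh r ^ 2 + ν₂ * Real.sinh r ^ 2, 0,
       (ν₁ + ν₂) / 2 * Real.sinh (2*r), 0;
     0, ν₁ * Real.cosh r ^ 2 + ν₂ * Real.sinh r ^ 2, 0,
       -((ν₁ + ν₂) / 2 * Real.sinh (2*r));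
     (ν₁ + ν₂) / 2 * Real.sinh (2*r), 0,
       ν₁ * Real.sinh r ^ 2 + ν₂ * Real.cosh r ^ 2, 0;
     0, -((ν₁ + ν₂) / 2 * Real.sinh (2*r)), 0,
       ν₁ * Real.sinh r ^ 2 + ν₂ * Real.cosh r ^ 2]

noncomputable def Aeng (α : ℝ) : Matrix (Fin 4) (Fin 4) ℝ :=
  (1/2 : ℝ) •
    !![Real.cosh (2*α), 0, -Real.sinh (2*α), 0;
       0, Real.cosh (2*α), 0, Real.sinh (2*α);
       -Real.sinh (2*α), 0, Real.cosh (2*α), 0;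
       0, Real.sinh (2*α), 0, Real.cosh (2*α)]

theorem cosh_two_mul_sub_eq (r α : ℝ) :
    Real.cosh (2 * (r - α)) = (Real.cosh r ^ 2 + Real.sinh r ^ 2) * Real.cosh (2 * α)
      - 2 * Real.sinh r * Real.cosh r * Real.sinh (2 * α) := by
  rw [mul_sub, Real.cosh_sub, Real.cosh_two_mul r, Real.sinh_two_mul r]

theorem sinh_two_mul_sub_eq (r α : ℝ) :
    Real.sinh (2 * (r - α)) = 2 * Real.sinh r * Real.cosh r * Real.cosh (2 * α)
      - (Real.cosh r ^ 2 + Real.sinh r ^ 2) * Real.sinh (2 * α) := by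
  rw [mul_sub, Real.sinh_sub, Real.cosh_two_mul r, Real.sinh_two_mul r]

theorem stmt_17 (α : ℝ) (ν₁ ν₂ r : ℝ) (h1 : 1/2 ≤ ν₁) (h2 : 1/2 ≤ ν₂)
    (hr : 0 < r) :
    (∃ G : Matrix (Fin 4) (Fin 4) ℝ, Gᵀ = G ∧
        J4 * G * Vsf ν₁ ν₂ r - Vsf ν₁ ν₂ r * G * J4
          + (J4 * ((1/2 : ℝ) • J4) * Vsf ν₁ ν₂ r
            + Vsf ν₁ ν₂ r * ((1/2 : ℝ) • J4) * J4
            - J4 * Aeng α * J4) = 0) ↔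
    (ν₁ = Real.cosh (2*(r - α)) / 2 ∧ ν₂ = Real.cosh (2*(r - α)) / 2) := by
  have hcs : (Real.cosh r ^ 2 - Real.sinh r ^ 2) ^ 2 = 1 := by
    rw [Real.cosh_sq_sub_sinh_sq, one_pow]
  have hC := cosh_two_mul_sub_eq r α
  have hS := sinh_two_mul_sub_eq r α
  have hr2 := Real.sinh_two_mul r
  constructor
  · rintro ⟨G, hG, hE⟩
    have hsymm (i j : Fin 4) : G i j = G j i := congrFun₂ hG j i
    have h00 := congrFun₂ hE 0 0
    have h11 := congrFun₂ hE 1 1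
    have h22 := congrFun₂ hE 2 2
    have h33 := congrFun₂ hE 3 3
    have h02 := congrFun₂ hE 0 2
    have h13 := congrFun₂ hE 1 3
    simp only [Matrix.add_apply, Matrix.sub_apply, Matrix.zero_apply, Matrix.mul_apply,
      Matrix.smul_apply, Fin.sum_univ_four] at h00 h11 h22 h33 h02 h13
    simp [J4, Vsf, Aeng, hr2, hsymm 1 0, hsymm 2 0, hsymm 3 0, hsymm 2 1, hsymm 3 1,
      hsymm 3 2] at h00 h11 h22 h33 h02 h13
    constructor
    · linear_combination (-1 / 2) * (Real.cosh r ^ 2 * (h00 + h11) + Real.sinh r ^ 2 * (h22 + h33)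
        - 2 * Real.cosh r * Real.sinh r * (h02 - h13)) - hC / 2 - ν₁ * hcs
    · linear_combination (-1 / 2) * (Real.sinh r ^ 2 * (h00 + h11) + Real.cosh r ^ 2 * (h22 + h33)
        - 2 * Real.cosh r * Real.sinh r * (h02 - h13)) - hC / 2 - ν₂ * hcs
  · rintro ⟨e1, e2⟩
    have hpos := Real.cosh_pos (2 * (r - α))
    obtain ⟨k, hk⟩ : ∃ k, Real.sinh (2 * (r - α)) = 2 * k * Real.cosh (2 * (r - α)) :=
      ⟨Real.sinh (2 * (r - α)) / (2 * Real.cosh (2 * (r - α))), by field_simp⟩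
    refine ⟨!![0, 0, 0, k; 0, 0, k, 0; 0, k, 0, 0; k, 0, 0, 0], ?_, ?_⟩
    · ext i j
      fin_cases i <;> fin_cases j <;> rfl
    · obtain rfl : ν₂ = ν₁ := e2.trans e1.symm
      have hc : Real.cosh (2 * (r - α)) = 2 * ν₂ := by linarith
      rw [hc] at hk hC
      rw [hk] at hS
      have hA : Real.cosh (2 * α) = 2 * ν₂ * (Real.cosh r ^ 2 + Real.sinh r ^ 2)
          - 8 * Real.sinh r * Real.cosh r * k * ν₂ := by
        linear_combination -Real.cosh (2 * α) * hcs - (Real.cosh r ^ 2 + Real.sinh r ^ 2) * hC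
          + 2 * Real.sinh r * Real.cosh r * hS
      have hB : Real.sinh (2 * α) = 4 * Real.sinh r * Real.cosh r * ν₂
          - 4 * (Real.cosh r ^ 2 + Real.sinh r ^ 2) * k * ν₂ := by
        linear_combination -Real.sinh (2 * α) * hcs - 2 * Real.sinh r * Real.cosh r * hC
          + (Real.cosh r ^ 2 + Real.sinh r ^ 2) * hS
      ext i j
      simp only [Matrix.add_apply, Matrix.sub_apply, Matrix.zero_apply, Matrix.mul_apply,
        Matrix.smul_apply, Fin.sum_univ_four]
      fin_cases i <;> fin_cases j <;> simp [J4, Vsf, Aeng, hr2, hA, hB] <;> ring
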